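/- Let A be an m×n matrix of nonnegative real entries with Σ_{i∈R} Σ_{j∈C} a_{ij} = 1 and with all row-sums and column-sums positive. Let 0 < δ < 1/4, let X* ⊆ X ⊆ R and Y* ⊆ Y ⊆ C be nonempty with Vol(X*)/Vol(X) ≥ 1−δ and Vol(Y*)/Vol(Y) ≥ 1−δ, and let K be any real number such that ρ(X',Y') ≤ K for all nonempty X' ⊆ R and Y' ⊆ C. Then |ρ(X*,Y*) − ρ(X,Y)| ≤ 4δ·K. -/

import Mathlib

open Finset

/-- The cut `a(X,Y)` between a row-subset `X` and a column-subset `Y`. -/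
noncomputable def cut {m n : ℕ} (A : Matrix (Fin m) (Fin n) ℝ)
    (X : Finset (Fin m)) (Y : Finset (Fin n)) : ℝ :=
  ∑ i ∈ X, ∑ j ∈ Y, A i j

/-- The volume `V(X)` of a row-subset `X`. -/
noncomputable def rowVol {m n : ℕ} (A : Matrix (Fin m) (Fin n) ℝ)
    (X : Finset (Fin m)) : ℝ :=
  ∑ i ∈ X, ∑ j, A i j

/-- The volume `V(Y)` of a column-subset `Y`. -/
noncomputable def colVol {m n : ℕ} (A : Matrix (Fin m) (Fin n) ℝ)
    (Y : Finset (Fin n)) : ℝ :=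
  ∑ j ∈ Y, ∑ i, A i j

/-- The density `d(X,Y) = a(X,Y)/(V(X)·V(Y))`. -/
noncomputable def density {m n : ℕ} (A : Matrix (Fin m) (Fin n) ℝ)
    (X : Finset (Fin m)) (Y : Finset (Fin n)) : ℝ :=
  cut A X Y / (rowVol A X * colVol A Y)

lemma cut_le_aux {m n : ℕ} (A : Matrix (Fin m) (Fin n) ℝ)
    (hrow : ∀ i, 0 < ∑ j, A i j)
    (hcol : ∀ j, 0 < ∑ i, A i j) (K : ℝ)
    (hK : ∀ (X'' : Finset (Fin m)) (Y'' : Finset (Fin n)),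
      X''.Nonempty → Y''.Nonempty → density A X'' Y'' ≤ K)
    (X : Finset (Fin m)) (Y : Finset (Fin n)) :
    cut A X Y ≤ K * (rowVol A X * colVol A Y) := by
  rcases X.eq_empty_or_nonempty with rfl | hX
  · simp [cut, rowVol]
  rcases Y.eq_empty_or_nonempty with rfl | hY
  · simp [cut, colVol]
  have h := hK X Y hX hY
  have hx : 0 < rowVol A X := Finset.sum_pos (fun i _ => hrow i) hX
  have hy : 0 < colVol A Y := Finset.sum_pos (fun i _ => hcol i) hY
  unfold density at h
  rwa [div_le_iff₀ (mul_pos hx hy)] at h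

/-- The change of density is at most `4δK`. -/
theorem density_change_le {m n : ℕ} (A : Matrix (Fin m) (Fin n) ℝ)
    (hA : ∀ i j, 0 ≤ A i j)
    (hsum : ∑ i, ∑ j, A i j = 1)
    (hrow : ∀ i, 0 < ∑ j, A i j)
    (hcol : ∀ j, 0 < ∑ i, A i j)
    (δ : ℝ) (hδ0 : 0 < δ) (hδ : δ < 1 / 4)
    (X' X : Finset (Fin m)) (Y' Y : Finset (Fin n))
    (hX'ne : X'.Nonempty) (hX'X : X' ⊆ X)
    (hY'ne : Y'.Nonempty) (hY'Y : Y' ⊆ Y)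
    (hVX : rowVol A X' / rowVol A X ≥ 1 - δ)
    (hVY : colVol A Y' / colVol A Y ≥ 1 - δ)
    (K : ℝ)
    (hK : ∀ (X'' : Finset (Fin m)) (Y'' : Finset (Fin n)),
      X''.Nonempty → Y''.Nonempty → density A X'' Y'' ≤ K) :
    |density A X' Y' - density A X Y| ≤ 4 * δ * K := by
  have hx' : 0 < rowVol A X' := Finset.sum_pos (fun i _ => hrow i) hX'ne
  have hy' : 0 < colVol A Y' := Finset.sum_pos (fun i _ => hcol i) hY'ne
  have hx : 0 < rowVol A X := Finset.sum_pos (fun i _ => hrow i) (hX'ne.mono hX'X)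
  have hy : 0 < colVol A Y := Finset.sum_pos (fun i _ => hcol i) (hY'ne.mono hY'Y)
  have c0 : ∀ S T, 0 ≤ cut A S T := fun S T =>
    Finset.sum_nonneg fun i _ => Finset.sum_nonneg fun j _ => hA i j
  have ex : rowVol A (X \ X') = rowVol A X - rowVol A X' := by
    have := Finset.sum_sdiff (f := fun i => ∑ j, A i j) hX'X
    unfold rowVol; linarith
  have ey : colVol A (Y \ Y') = colVol A Y - colVol A Y' := by
    have := Finset.sum_sdiff (f := fun j => ∑ i, A i j) hY'Y
    unfold colVol; linarith
  have ec : cut A X Y = cut A (X \ X') Y + cut A X' (Y \ Y') + cut A X' Y' := by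
    have h1 := Finset.sum_sdiff (f := fun i => ∑ j ∈ Y, A i j) hX'X
    have h2 : cut A X' Y = cut A X' (Y \ Y') + cut A X' Y' := by
      unfold cut
      rw [← Finset.sum_add_distrib]
      exact Finset.sum_congr rfl fun i _ => (Finset.sum_sdiff hY'Y).symm
    unfold cut at *; linarith
  have k1 := cut_le_aux A hrow hcol K hK (X \ X') Y
  have k2 := cut_le_aux A hrow hcol K hK X' (Y \ Y')
  have k3 := cut_le_aux A hrow hcol K hK X' Y'
  have n1 := c0 (X \ X') Y
  have n2 := c0 X' (Y \ Y')
  have n3 := c0 X' Y'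
  have gx : 0 ≤ rowVol A (X \ X') := Finset.sum_nonneg fun i _ => (hrow i).le
  have gy : 0 ≤ colVol A (Y \ Y') := Finset.sum_nonneg fun i _ => (hcol i).le
  have hK0 : 0 ≤ K := le_trans
    (div_nonneg n3 (mul_pos hx' hy').le) (hK X' Y' hX'ne hY'ne)
  rw [ge_iff_le, le_div_iff₀ hx] at hVX
  rw [ge_iff_le, le_div_iff₀ hy] at hVY
  rw [ex] at k1 gx
  rw [ey] at k2 gy
  unfold density
  generalize cut A X Y = c at *
  generalize cut A X' Y' = c' at *
  generalize cut A (X \ X') Y = c1 at *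
  generalize cut A X' (Y \ Y') = c2 at *
  generalize rowVol A X = x at *
  generalize rowVol A X' = x' at *
  generalize colVol A Y = y at *
  generalize colVol A Y' = y' at *
  have hxy := mul_pos hx hy
  have hxy' := mul_pos hx' hy'
  have hδK : 0 ≤ δ * K := mul_nonneg hδ0.le hK0
  have q : (x - x') * y + x' * (y - y') ≤ 2 * δ * (x * y) := by
    have a1 : (x - x') * y ≤ (δ * x) * y :=
      mul_le_mul_of_nonneg_right (by linarith) hy.le
    have a2 : x' * (y - y') ≤ x * (δ * y) :=
      mul_le_mul (by linarith) (by linarith) gy hx.le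
    linarith
  have qK := mul_le_mul_of_nonneg_left q hK0
  have hle : x' * y' ≤ x * y := mul_le_mul (by linarith) (by linarith) hy'.le hx.le
  have r1 : c' / (x * y) ≤ c' / (x' * y') := div_le_div_of_nonneg_left n3 hxy' hle
  have r2 : c / (x * y) ≤ c' / (x * y) + 2 * δ * K := by
    rw [div_add' _ _ _ hxy.ne']
    apply div_le_div_of_nonneg_right _ hxy.le
    linarith
  have r3 : c' / (x * y) ≤ c / (x * y) :=
    div_le_div_of_nonneg_right (by linarith) hxy.le
  have r4 : c' / (x' * y') ≤ c' / (x * y) + 2 * δ * K := by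
    have e : c' = c' / (x' * y') * (x' * y') := by field_simp
    have f : c' / (x' * y') ≤ K := by rwa [div_le_iff₀ hxy']
    have f0 : 0 ≤ c' / (x' * y') := div_nonneg n3 hxy'.le
    generalize c' / (x' * y') = r at *
    rw [div_add' _ _ _ hxy.ne', le_div_iff₀ hxy]
    have g : r * (x * y - x' * y') ≤ K * (x * y - x' * y') :=
      mul_le_mul_of_nonneg_right f (by linarith)
    linarith
  rw [abs_le]
  constructor <;> linarith
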